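/- Equip the Baire space ℕ^ℕ with the metric d(x,y) = 1/2^{n+1} where n is the least index with x(n) ≠ y(n) (and d(x,x) = 0); this is a complete metric. If for every target set T ⊆ ℕ^ℕ Schmidt's (1/2, 1/2, 1/2) game on (ℕ^ℕ, d) with target set T is determined, then AD holds. -/

import Mathlib

open Filter Topology

/-- The history (the list of moves) of the first `n` moves of the run `f`. -/
def histOf {M : Type*} (f : ℕ → M) (n : ℕ) : List M := (List.range n).map f

/-- The axiom of determinacy `AD` for integer games: for every payoff set
`A ⊆ ℕ^ℕ`, in the game where I plays `x (2k)` and II plays `x (2k+1)`, and I wins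
iff `x ∈ A`, one of the players has a winning strategy. -/
def AD : Prop :=
  ∀ A : Set (ℕ → ℕ),
    (∃ σ : List ℕ → ℕ, ∀ x : ℕ → ℕ, (∀ k, x (2 * k) = σ (histOf x (2 * k))) → x ∈ A) ∨
    (∃ τ : List ℕ → ℕ, ∀ x : ℕ → ℕ, (∀ k, x (2 * k + 1) = τ (histOf x (2 * k + 1))) → x ∉ A)

/-- A specification of an infinite two-player game with moves in `M`:
`firstOK` constrains the first move, `moveOK` constrains every single move,
`stepOK i` constrains consecutive moves (at indices `i`, `i+1`), and `payoffII`
is the winning condition for player II on rule-following runs. -/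
structure GameSpec (M : Type*) where
  firstOK : M → Prop
  moveOK : M → Prop
  stepOK : ℕ → M → M → Prop
  payoffII : (ℕ → M) → Prop

namespace GameSpec

variable {M : Type*} (G : GameSpec M)

/-- The first `n` moves of the run `f` follow the rules. -/
def LegalUpTo (f : ℕ → M) (n : ℕ) : Prop :=
  (0 < n → G.firstOK (f 0)) ∧ (∀ i < n, G.moveOK (f i)) ∧
    ∀ i, i + 1 < n → G.stepOK i (f i) (f (i + 1))

/-- The whole run `f` follows the rules. -/
def Legal (f : ℕ → M) : Prop :=
  G.firstOK (f 0) ∧ (∀ i, G.moveOK (f i)) ∧ ∀ i, G.stepOK i (f i) (f (i + 1))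

/-- A finite position (a finite sequence of moves) follows the rules. -/
def ListLegal (p : List M) : Prop :=
  ∃ f : ℕ → M, histOf f p.length = p ∧ G.LegalUpTo f p.length

/-- Player I (who makes the even-indexed moves) follows strategy `σ` in the run `f`. -/
def FollowsI (σ : List M → M) (f : ℕ → M) : Prop :=
  ∀ k, f (2 * k) = σ (histOf f (2 * k))

/-- Player II (who makes the odd-indexed moves) follows strategy `τ` in the run `f`. -/
def FollowsII (τ : List M → M) (f : ℕ → M) : Prop :=
  ∀ k, f (2 * k + 1) = τ (histOf f (2 * k + 1))

/-- `σ` is a winning strategy for player I: whenever player I follows `σ`, player I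
never violates the rules first, and if the whole run follows the rules then the run
is won by player I (i.e. it does not satisfy player II's payoff condition). -/
def WinningI (σ : List M → M) : Prop :=
  ∀ f : ℕ → M, FollowsI σ f →
    (∀ n, G.LegalUpTo f (2 * n) → G.LegalUpTo f (2 * n + 1)) ∧
      (G.Legal f → ¬ G.payoffII f)

/-- `τ` is a winning strategy for player II: whenever player II follows `τ`, player II
never violates the rules first, and if the whole run follows the rules then the run
satisfies player II's payoff condition. -/
def WinningII (τ : List M → M) : Prop :=
  ∀ f : ℕ → M, FollowsII τ f →
    (∀ n, G.LegalUpTo f (2 * n + 1) → G.LegalUpTo f (2 * n + 2)) ∧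
      (G.Legal f → G.payoffII f)

/-- The game is determined: one of the two players has a winning strategy. -/
def Determined : Prop := (∃ σ, G.WinningI σ) ∨ (∃ τ, G.WinningII τ)

end GameSpec

/-- Schmidt's `(α, β)` game on the metric space `X` with target set `T`.
Moves are pairs `(center, radius)`; the first radius must be positive, each ball
must be contained in the previous one (`ρ_{i+1} + d(x_i, x_{i+1}) ≤ ρ_i`), radii
shrink by `α` after an even-indexed (player I) move and by `β` after an
odd-indexed (player II) move.  Player II wins a rule-following run iff the unique
point of intersection of the balls (the limit of the centers) lies in `T`. -/
def schmidtGame {X : Type*} [MetricSpace X] (α β : ℝ) (T : Set X) :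
    GameSpec (X × ℝ) where
  firstOK m := 0 < m.2
  moveOK _ := True
  stepOK i prev next :=
    next.2 + dist prev.1 next.1 ≤ prev.2 ∧ next.2 = (if Even i then α else β) * prev.2
  payoffII f := ∃ z ∈ T, Tendsto (fun n => (f n).1) atTop (𝓝 z)

/-- Schmidt's `(α, β, ρ)` game: like the `(α, β)` game but the first radius must be `ρ`. -/
def schmidtGameFixed {X : Type*} [MetricSpace X] (α β ρ : ℝ) (T : Set X) :
    GameSpec (X × ℝ) :=
  { schmidtGame α β T with firstOK := fun m => m.2 = ρ }

/-- The metric on Baire space `ℕ^ℕ`: `d(x, y) = 1/2^(n+1)` where `n` is the least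
index with `x n ≠ y n`, and `d(x, x) = 0`. -/
noncomputable def baireDist (x y : ℕ → ℕ) : ℝ :=
  open scoped Classical in
  if h : x = y then 0 else (1 / 2 : ℝ) ^ (Nat.find (Function.ne_iff.mp h) + 1)

/-- Schmidt's `(1/2, 1/2, 1/2)` game on Baire space `ℕ^ℕ` equipped with the metric
`baireDist`, with target set `T`.  Player II wins a rule-following run iff the
centers converge (in the metric `baireDist`) to a point of `T`. -/
noncomputable def baireSchmidtGame (T : Set (ℕ → ℕ)) : GameSpec ((ℕ → ℕ) × ℝ) where
  firstOK m := m.2 = 1 / 2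
  moveOK _ := True
  stepOK i prev next :=
    next.2 + baireDist prev.1 next.1 ≤ prev.2 ∧
      next.2 = (if Even i then (1 / 2 : ℝ) else 1 / 2) * prev.2
  payoffII f := ∃ z ∈ T, Tendsto (fun n => baireDist (f n).1 z) atTop (𝓝 0)

lemma histOf_succ {M : Type*} (f : ℕ → M) (n : ℕ) :
    histOf f (n + 1) = histOf f n ++ [f n] := by
  simp [histOf, List.range_succ]

lemma length_histOf {M : Type*} (f : ℕ → M) (n : ℕ) : (histOf f n).length = n := by
  simp [histOf]

lemma baireDist_le_iff (x y : ℕ → ℕ) (n : ℕ) :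
    baireDist x y ≤ (1 / 2 : ℝ) ^ (n + 1) ↔ ∀ i < n, x i = y i := by
  classical
  unfold baireDist
  split_ifs with h
  · subst h
    simp
  · rw [pow_le_pow_iff_right_of_lt_one₀ (by norm_num) (by norm_num), Nat.add_le_add_iff_right,
      Nat.le_find_iff]
    simp

lemma baireDist_nonneg (x y : ℕ → ℕ) : 0 ≤ baireDist x y := by
  unfold baireDist
  split_ifs <;> positivity

/-- The position at stage `n` of a run of `baireSchmidtGame` is legal iff the radii are
`1/2^(i+1)` and each center agrees with the previous one on the coordinates fixed so far. -/
lemma baireSchmidtGame_legalUpTo_iff (T : Set (ℕ → ℕ)) (f : ℕ → (ℕ → ℕ) × ℝ) (n : ℕ) :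
    (baireSchmidtGame T).LegalUpTo f n ↔
      (∀ i < n, (f i).2 = (1 / 2 : ℝ) ^ (i + 1)) ∧
        ∀ i, i + 1 < n → ∀ j < i + 1, (f i).1 j = (f (i + 1)).1 j := by
  have key (i : ℕ) (h₁ : (f i).2 = (1 / 2 : ℝ) ^ (i + 1))
      (h₂ : (f (i + 1)).2 = (1 / 2 : ℝ) ^ (i + 2)) :
      (f (i + 1)).2 + baireDist (f i).1 (f (i + 1)).1 ≤ (f i).2 ↔
        ∀ j < i + 1, (f i).1 j = (f (i + 1)).1 j := by
    rw [← baireDist_le_iff, h₁, h₂, pow_succ _ (i + 1)]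
    constructor <;> intro h <;> linarith
  simp only [GameSpec.LegalUpTo, baireSchmidtGame, ite_self, implies_true, true_and]
  constructor
  · rintro ⟨h0, hs⟩
    have hr : ∀ i < n, (f i).2 = (1 / 2 : ℝ) ^ (i + 1) := by
      intro i
      induction i with
      | zero => intro hi; simpa using h0 hi
      | succ i ih =>
        intro hi
        rw [(hs i hi).2, ih (by omega), pow_succ' _ (i + 1)]
    exact ⟨hr, fun i hi => (key i (hr i (by omega)) (hr _ hi)).1 (hs i hi).1⟩
  · rintro ⟨hr, hs⟩
    refine ⟨fun hn => by simpa using hr 0 hn, fun i hi =>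
      ⟨(key i (hr i (by omega)) (hr _ hi)).2 (hs i hi), ?_⟩⟩
    rw [hr _ hi, hr i (by omega), pow_succ' _ (i + 1)]

lemma GameSpec.legal_of_forall_legalUpTo {M : Type*} (G : GameSpec M) (f : ℕ → M)
    (h : ∀ n, G.LegalUpTo f n) : G.Legal f :=
  ⟨(h 1).1 one_pos, fun i => (h (i + 1)).2.1 i (by omega),
    fun i => (h (i + 2)).2.2 i (by omega)⟩

/-- The move after the position `h` which keeps the coordinates fixed so far and makes `a`
the value of the next coordinate. -/
noncomputable def coordMove (h : List ((ℕ → ℕ) × ℝ)) (a : ℕ) : (ℕ → ℕ) × ℝ :=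
  (fun i => if i < h.length then (h.getLastD (0, 0)).1 i else a, (1 / 2) ^ (h.length + 1))

/-- The move made in the simulation of an integer game: the player moving at stages congruent
to `b` modulo `2` uses the strategy `σ`, the opponent plays the integer `a`. -/
noncomputable def simMove (σ : List ((ℕ → ℕ) × ℝ) → (ℕ → ℕ) × ℝ) (b : ℕ)
    (h : List ((ℕ → ℕ) × ℝ)) (a : ℕ) : (ℕ → ℕ) × ℝ :=
  if h.length % 2 = b then σ h else coordMove h a

/-- The position of the Schmidt game simulating a position of an integer game. -/
noncomputable def simHist (σ : List ((ℕ → ℕ) × ℝ) → (ℕ → ℕ) × ℝ) (b : ℕ) (s : List ℕ) :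
    List ((ℕ → ℕ) × ℝ) :=
  s.foldl (fun h a => h ++ [simMove σ b h a]) []

/-- The run of the Schmidt game simulating a run of an integer game. -/
noncomputable def simRun (σ : List ((ℕ → ℕ) × ℝ) → (ℕ → ℕ) × ℝ) (b : ℕ) (x : ℕ → ℕ)
    (n : ℕ) : (ℕ → ℕ) × ℝ :=
  simMove σ b (simHist σ b (histOf x n)) (x n)

/-- The strategy in the integer game read off from a strategy in the Schmidt game. -/
noncomputable def simStrategy (σ : List ((ℕ → ℕ) × ℝ) → (ℕ → ℕ) × ℝ) (b : ℕ)
    (s : List ℕ) : ℕ :=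
  (σ (simHist σ b s)).1 s.length

section Simulation

variable (σ : List ((ℕ → ℕ) × ℝ) → (ℕ → ℕ) × ℝ) (b : ℕ) (x : ℕ → ℕ)

lemma simHist_histOf (n : ℕ) : simHist σ b (histOf x n) = histOf (simRun σ b x) n := by
  induction n with
  | zero => rfl
  | succ n ih =>
    rw [histOf_succ (simRun σ b x), ← ih, histOf_succ]
    simp [simHist, simRun]

lemma simRun_of_turn {n : ℕ} (hn : n % 2 = b) :
    simRun σ b x n = σ (histOf (simRun σ b x) n) := by
  conv_lhs => rw [simRun, simHist_histOf, simMove, length_histOf, if_pos hn]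

lemma simRun_of_not_turn {n : ℕ} (hn : n % 2 ≠ b) :
    simRun σ b x n = coordMove (histOf (simRun σ b x) n) (x n) := by
  conv_lhs => rw [simRun, simHist_histOf, simMove, length_histOf, if_neg hn]

variable {σ b x}

lemma simRun_apply_self (hx : ∀ n, n % 2 = b → x n = simStrategy σ b (histOf x n)) (n : ℕ) :
    (simRun σ b x n).1 n = x n := by
  by_cases hn : n % 2 = b
  · rw [simRun_of_turn σ b x hn, hx n hn, simStrategy, simHist_histOf, length_histOf]
  · rw [simRun_of_not_turn σ b x hn]
    simp [coordMove, length_histOf]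

lemma simRun_legalUpTo (T : Set (ℕ → ℕ))
    (hσ : ∀ n, n % 2 = b → (baireSchmidtGame T).LegalUpTo (simRun σ b x) n →
      (baireSchmidtGame T).LegalUpTo (simRun σ b x) (n + 1)) (n : ℕ) :
    (baireSchmidtGame T).LegalUpTo (simRun σ b x) n := by
  induction n with
  | zero => simp [baireSchmidtGame_legalUpTo_iff]
  | succ n ih =>
    by_cases hn : n % 2 = b
    · exact hσ n hn ih
    · rw [baireSchmidtGame_legalUpTo_iff] at ih ⊢
      have hmove := simRun_of_not_turn σ b x hn
      refine ⟨fun i hi => ?_, fun i hi j hj => ?_⟩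
      · rcases Nat.lt_succ_iff_lt_or_eq.1 hi with hi | rfl
        · exact ih.1 i hi
        · rw [hmove]
          simp [coordMove, length_histOf]
      · rcases Nat.lt_succ_iff_lt_or_eq.1 hi with hi | rfl
        · exact ih.2 i hi j hj
        · rw [hmove]
          simp only [coordMove, length_histOf, if_pos hj]
          simp [histOf_succ]

lemma tendsto_baireDist_simRun {T : Set (ℕ → ℕ)}
    (hx : ∀ n, n % 2 = b → x n = simStrategy σ b (histOf x n))
    (hleg : ∀ n, (baireSchmidtGame T).LegalUpTo (simRun σ b x) n) :
    Tendsto (fun n => baireDist (simRun σ b x n).1 x) atTop (𝓝 0) := by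
  have hagree (n : ℕ) : ∀ i < n + 1, (simRun σ b x n).1 i = x i := by
    induction n with
    | zero =>
      intro i hi
      obtain rfl : i = 0 := by omega
      exact simRun_apply_self hx 0
    | succ n ih =>
      intro i hi
      rcases Nat.lt_succ_iff_lt_or_eq.1 hi with hi | rfl
      · rw [← ((baireSchmidtGame_legalUpTo_iff T _ _).1 (hleg (n + 2))).2 n (by omega) i hi]
        exact ih i hi
      · exact simRun_apply_self hx _
  have hpow : Tendsto (fun n : ℕ => (1 / 2 : ℝ) ^ (n + 1 + 1)) atTop (𝓝 0) :=
    (tendsto_pow_atTop_nhds_zero_of_lt_one (by norm_num) (by norm_num)).comp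
      (tendsto_add_atTop_nat 2)
  exact squeeze_zero (fun _ => baireDist_nonneg _ _)
    (fun n => (baireDist_le_iff _ _ _).2 (hagree n)) hpow

end Simulation

lemma eq_of_tendsto_baireDist {u : ℕ → ℕ → ℕ} {y z : ℕ → ℕ}
    (hy : Tendsto (fun n => baireDist (u n) y) atTop (𝓝 0))
    (hz : Tendsto (fun n => baireDist (u n) z) atTop (𝓝 0)) : y = z := by
  funext i
  have hpos : (0 : ℝ) < (1 / 2) ^ (i + 1 + 1) := by positivity
  obtain ⟨n, hny, hnz⟩ := ((hy.eventually_le_const hpos).and (hz.eventually_le_const hpos)).exists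
  rw [← (baireDist_le_iff _ _ _).1 hny i (by omega), (baireDist_le_iff _ _ _).1 hnz i (by omega)]

/-- If Schmidt's `(1/2, 1/2, 1/2)` game on Baire space `ℕ^ℕ` (with the metric
`d(x,y) = 1/2^(n+1)`, `n` least with `x n ≠ y n`) is determined for every target
set `T ⊆ ℕ^ℕ`, then `AD` holds. -/
theorem AD_of_baire_schmidt_determinacy
    (hdet : ∀ T : Set (ℕ → ℕ), (baireSchmidtGame T).Determined) : AD := by
  intro A
  rcases hdet Aᶜ with ⟨σ, hσ⟩ | ⟨τ, hτ⟩
  · refine Or.inl ⟨simStrategy σ 0, fun x hx => ?_⟩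
    have hx' : ∀ n, n % 2 = 0 → x n = simStrategy σ 0 (histOf x n) := by
      intro n hn
      obtain ⟨k, rfl⟩ : ∃ k, n = 2 * k := ⟨n / 2, by omega⟩
      exact hx k
    obtain ⟨hrules, hwin⟩ := hσ (simRun σ 0 x) fun k => simRun_of_turn σ 0 x (by omega)
    have hleg := simRun_legalUpTo Aᶜ (σ := σ) (b := 0) (x := x) fun n hn h => by
      obtain ⟨k, rfl⟩ : ∃ k, n = 2 * k := ⟨n / 2, by omega⟩
      exact hrules k h
    by_contra hxA
    exact hwin (GameSpec.legal_of_forall_legalUpTo _ _ hleg)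
      ⟨x, hxA, tendsto_baireDist_simRun hx' hleg⟩
  · refine Or.inr ⟨simStrategy τ 1, fun x hx => ?_⟩
    have hx' : ∀ n, n % 2 = 1 → x n = simStrategy τ 1 (histOf x n) := by
      intro n hn
      obtain ⟨k, rfl⟩ : ∃ k, n = 2 * k + 1 := ⟨n / 2, by omega⟩
      exact hx k
    obtain ⟨hrules, hwin⟩ := hτ (simRun τ 1 x) fun k => simRun_of_turn τ 1 x (by omega)
    have hleg := simRun_legalUpTo Aᶜ (σ := τ) (b := 1) (x := x) fun n hn h => by
      obtain ⟨k, rfl⟩ : ∃ k, n = 2 * k + 1 := ⟨n / 2, by omega⟩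
      exact hrules k h
    obtain ⟨z, hzT, hz⟩ := hwin (GameSpec.legal_of_forall_legalUpTo _ _ hleg)
    rwa [eq_of_tendsto_baireDist hz (tendsto_baireDist_simRun hx' hleg)] at hzT
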